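/- There exist constants C>1 and α>0 such that for every 0<ε<1/2 and all a, d ∈ ℕ with d ≥ C·(a + log₂(1/ε)), there exists a function AdvCB : {0,1}^d × {0,1}^d × {0,1}^a → {0,1}^m with output length m ≥ α·d that is a (0.9d, 0.9d, ε) strong correlation breaker with advice. (Explicitness/efficient computability is omitted; only existence is asserted.) -/

import Mathlib

/-- `Bits n` is the set of `n`-bit strings `{0,1}^n`. -/
abbrev Bits (n : ℕ) : Type := Fin n → Bool

/-- Statistical distance `Δ(p,q) = max_{T ⊆ S} |p(T) - q(T)|`. -/
noncomputable def sd {α : Type*} [Fintype α] (p q : PMF α) : ℝ :=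
  ⨆ T : Finset α, |∑ x ∈ T, (p x).toReal - ∑ x ∈ T, (q x).toReal|

/-- `X` has min-entropy at least `k`, i.e. `Pr[X = x] ≤ 2^{-k}` for all `x`. -/
def minEntropyGe {α : Type*} (p : PMF α) (k : ℝ) : Prop :=
  ∀ x, (p x).toReal ≤ (2 : ℝ) ^ (-k)

/-- Joint distribution of two independent random variables. -/
noncomputable def prodPMF {α β : Type*} (p : PMF α) (q : PMF β) : PMF (α × β) :=
  p.bind fun x => q.map fun y => (x, y)

/-- `CB` is a `(k, k', ε)` strong correlation breaker with advice: whenever `(X, X')`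
(joint distribution `PX`) with `H∞(X) ≥ k` is independent of `(Y, Y')` (joint
distribution `PY`) with `H∞(Y) ≥ k'`, and `α ≠ α'` are distinct advice strings, then
`Δ((CB(X,Y,α), CB(X',Y',α'), Y, Y'), (U_m, CB(X',Y',α'), Y, Y')) ≤ ε`. -/
def IsStrongAdvCB {n n' a m : ℕ} (k k' ε : ℝ)
    (CB : Bits n → Bits n' → Bits a → Bits m) : Prop :=
  ∀ (PX : PMF (Bits n × Bits n)) (PY : PMF (Bits n' × Bits n')),
    minEntropyGe (PX.map Prod.fst) k → minEntropyGe (PY.map Prod.fst) k' →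
    ∀ αa αb : Bits a, αa ≠ αb →
      sd ((prodPMF PX PY).map fun p => (CB p.1.1 p.2.1 αa, CB p.1.2 p.2.2 αb, p.2))
         (prodPMF (PMF.uniformOfFintype (Bits m))
           ((prodPMF PX PY).map fun p => (CB p.1.2 p.2.2 αb, p.2))) ≤ ε

section MomentMethod

variable {Ω E J M : Type*}

/-- Union bound in exponential-moment form. -/
lemma exists_forall_lt_of_sum_exp_le [Fintype Ω] [Nonempty Ω] [Fintype E] (Z : E → Ω → ℝ)
    {l b τ : ℝ} (hl : 0 ≤ l)
    (hZ : ∀ e, ∑ ω, Real.exp (l * Z e ω) ≤ Fintype.card Ω * b)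
    (hb : Fintype.card E * b < Real.exp (l * τ)) :
    ∃ ω, ∀ e, Z e ω < τ := by
  by_contra! h
  have h1 : ∀ ω, Real.exp (l * τ) ≤ ∑ e, Real.exp (l * Z e ω) := fun ω => by
    obtain ⟨e, he⟩ := h ω
    refine le_trans (Real.exp_le_exp.2 (mul_le_mul_of_nonneg_left he hl)) ?_
    exact Finset.single_le_sum (f := fun e => Real.exp (l * Z e ω))
      (fun _ _ => (Real.exp_pos _).le) (Finset.mem_univ e)
  have h2 : (Fintype.card Ω : ℝ) * Real.exp (l * τ)
      ≤ Fintype.card Ω * (Fintype.card E * b) := by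
    calc (Fintype.card Ω : ℝ) * Real.exp (l * τ) = ∑ _ω : Ω, Real.exp (l * τ) := by simp
      _ ≤ ∑ ω, ∑ e, Real.exp (l * Z e ω) := Finset.sum_le_sum fun ω _ => h1 ω
      _ = ∑ e, ∑ ω, Real.exp (l * Z e ω) := Finset.sum_comm
      _ ≤ ∑ _e : E, Fintype.card Ω * b := Finset.sum_le_sum fun e _ => hZ e
      _ = Fintype.card Ω * (Fintype.card E * b) := by simp; ring
  have h3 : (0 : ℝ) < Fintype.card Ω := by exact_mod_cast Fintype.card_pos
  exact absurd (le_of_mul_le_mul_left h2 h3) (not_le.2 hb)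

lemma sum_exp_mul_le [Fintype M] (c : M → ℝ) {l : ℝ} (hl : |l| ≤ 1) (hc : ∀ u, |c u| ≤ 1)
    (h0 : ∑ u, c u = 0) :
    ∑ u, Real.exp (l * c u) ≤ Fintype.card M * Real.exp (l ^ 2) := by
  have h : ∀ u, Real.exp (l * c u) ≤ l * c u + Real.exp (l ^ 2) := fun u => by
    have h1 : |l * c u| ≤ 1 := by
      rw [abs_mul]
      exact mul_le_one₀ hl (abs_nonneg _) (hc u)
    have h2 := (abs_le.1 (Real.abs_exp_sub_one_sub_id_le h1)).2
    have h3 : (c u) ^ 2 ≤ 1 := (sq_le_one_iff_abs_le_one _).2 (hc u)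
    have h4 := Real.add_one_le_exp (l ^ 2)
    nlinarith [sq_nonneg l]
  calc ∑ u, Real.exp (l * c u) ≤ ∑ u, (l * c u + Real.exp (l ^ 2)) :=
        Finset.sum_le_sum fun u _ => h u
    _ = _ := by rw [Finset.sum_add_distrib, ← Finset.mul_sum, h0]; simp

/-- Exponential moment of a sum of independent centred bounded variables. -/
lemma sum_exp_sum_le [Fintype J] [DecidableEq J] [Fintype M] (S : Finset J) (c : J → M → ℝ)
    {l : ℝ} (hl : |l| ≤ 1) (hc : ∀ j u, |c j u| ≤ 1) (h0 : ∀ j, ∑ u, c j u = 0) :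
    ∑ A : J → M, Real.exp (l * ∑ j ∈ S, c j (A j)) ≤
      Fintype.card (J → M) * Real.exp (l ^ 2) ^ Fintype.card J := by
  have h1 : ∀ A : J → M, Real.exp (l * ∑ j ∈ S, c j (A j)) =
      ∏ j, Real.exp (l * if j ∈ S then c j (A j) else 0) := fun A => by
    rw [← Real.exp_sum, ← Finset.mul_sum, Finset.sum_ite_mem, Finset.univ_inter]
  have h2 : ∑ A : J → M, ∏ j, Real.exp (l * if j ∈ S then c j (A j) else 0) =
      ∏ j, ∑ u, Real.exp (l * if j ∈ S then c j u else 0) := by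
    rw [Finset.prod_univ_sum, Fintype.piFinset_univ]
  rw [Finset.sum_congr rfl fun A _ => h1 A, h2]
  calc _ ≤ ∏ _j : J, (Fintype.card M * Real.exp (l ^ 2)) := by
        refine Finset.prod_le_prod (fun j _ => Finset.sum_nonneg fun _ _ => (Real.exp_pos _).le)
          fun j _ => sum_exp_mul_le (fun u => if j ∈ S then c j u else 0) hl ?_ ?_
        · intro u
          split_ifs
          · exact hc j u
          · simp
        · split_ifs
          · exact h0 j
          · simp
    _ = _ := by simp [mul_pow]

end MomentMethod

section Deviation

variable {I X Y M : Type*}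

/-- Centred indicator of the test `t`. -/
noncomputable def testDev [Fintype M] (t : M → Bool) (u : M) : ℝ :=
  (if t u then 1 else 0) - (Fintype.card M : ℝ)⁻¹ * ∑ v, if t v then 1 else 0

lemma sum_testDev [Fintype M] [Nonempty M] (t : M → Bool) : ∑ u, testDev t u = 0 := by
  have : (Fintype.card M : ℝ) ≠ 0 := by exact_mod_cast Fintype.card_ne_zero
  simp only [testDev, Finset.sum_sub_distrib, Finset.sum_const, Finset.card_univ, nsmul_eq_mul]
  rw [mul_inv_cancel_left₀ this, sub_self]

lemma abs_testDev_le [Fintype M] [Nonempty M] (t : M → Bool) (u : M) : |testDev t u| ≤ 1 := by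
  have hM : (0 : ℝ) < Fintype.card M := by exact_mod_cast Fintype.card_pos
  have h1 : (0 : ℝ) ≤ ∑ v, if t v then (1 : ℝ) else 0 :=
    Finset.sum_nonneg fun v _ => by split_ifs <;> norm_num
  have h2 : (∑ v, if t v then (1 : ℝ) else 0) ≤ Fintype.card M := by
    calc _ ≤ ∑ _v : M, (1 : ℝ) := Finset.sum_le_sum fun v _ => by split_ifs <;> norm_num
      _ = _ := by simp
  have h3 := mul_le_mul_of_nonneg_left h2 (inv_nonneg.2 hM.le)
  rw [inv_mul_cancel₀ hM.ne'] at h3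
  have h4 := mul_nonneg (inv_nonneg.2 hM.le) h1
  unfold testDev
  rw [abs_le]
  split_ifs <;> constructor <;> linarith

lemma testDev_not [Fintype M] [Nonempty M] (t : M → Bool) (u : M) :
    testDev (fun v => !t v) u = -testDev t u := by
  have hM : (Fintype.card M : ℝ) ≠ 0 := by exact_mod_cast Fintype.card_ne_zero
  have h : ∀ v, (if (!t v) = true then (1 : ℝ) else 0) = 1 - if t v then 1 else 0 := fun v => by
    cases t v <;> simp
  simp only [testDev, h, Finset.sum_sub_distrib, Finset.sum_const, Finset.card_univ,
    nsmul_eq_mul, mul_one, mul_sub, inv_mul_cancel₀ hM]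
  ring

/-- A random family of two-argument functions has small deviation on every rectangle, against
every tampering of both arguments and every test, provided the two indices are distinct. -/
lemma exists_forall_sum_testDev_lt [Fintype I] [DecidableEq I] [Fintype X] [DecidableEq X]
    [Fintype Y] [DecidableEq Y] [Fintype M] [DecidableEq M] [Nonempty M] {l τ : ℝ}
    (hl : 0 ≤ l) (hl1 : l ≤ 1)
    (hcard : ((Fintype.card I ^ 2 * (2 ^ Fintype.card X * 2 ^ Fintype.card Y *
      (Fintype.card X ^ Fintype.card X * Fintype.card Y ^ Fintype.card Y) *
      ((2 ^ Fintype.card M) ^ Fintype.card M) ^ Fintype.card Y) : ℕ) : ℝ) *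
        Real.exp (l ^ 2) ^ (Fintype.card X * Fintype.card Y) < Real.exp (l * τ)) :
    ∃ F : I → X × Y → M, ∀ i j, i ≠ j → ∀ (S : Finset X) (R : Finset Y) (f : X → X) (g : Y → Y)
      (t : Y → M → M → Bool),
      ∑ p ∈ S ×ˢ R, testDev (fun v => t p.2 v (F j (f p.1, g p.2))) (F i p) < τ := by
  let E := {p : I × I // p.1 ≠ p.2} ×
    ((Finset X × Finset Y) × ((X → X) × (Y → Y))) × (Y → M → M → Bool)
  let Z : E → (I → X × Y → M) → ℝ := fun e F =>
    ∑ p ∈ e.2.1.1.1 ×ˢ e.2.1.1.2,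
      testDev (fun v => e.2.2 p.2 v (F e.1.1.2 (e.2.1.2.1 p.1, e.2.1.2.2 p.2))) (F e.1.1.1 p)
  suffices h : ∃ F, ∀ e, Z e F < τ by
    obtain ⟨F, hF⟩ := h
    exact ⟨F, fun i j hij S R f g t => hF (⟨(i, j), hij⟩, ((S, R), (f, g)), t)⟩
  refine exists_forall_lt_of_sum_exp_le Z (l := l)
    (b := Real.exp (l ^ 2) ^ (Fintype.card X * Fintype.card Y)) (τ := τ) hl ?_ ?_
  · rintro ⟨⟨⟨i, j⟩, hij⟩, ⟨⟨S, R⟩, f, g⟩, t⟩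
    have hij' : j ≠ i := Ne.symm hij
    rw [← (Equiv.piSplitAt i fun _ => X × Y → M).symm.sum_comp, Fintype.sum_prod_type,
      Finset.sum_comm, Fintype.card_congr (Equiv.piSplitAt i fun _ => X × Y → M),
      Fintype.card_prod]
    have key : ∀ B : (∀ _j : {j // j ≠ i}, X × Y → M),
        ∑ A : X × Y → M, Real.exp (l * Z (⟨(i, j), hij⟩, ((S, R), (f, g)), t)
          ((Equiv.piSplitAt i fun _ => X × Y → M).symm (A, B))) ≤
        Fintype.card (X × Y → M) * Real.exp (l ^ 2) ^ (Fintype.card X * Fintype.card Y) := by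
      intro B
      have := sum_exp_sum_le (M := M) (S ×ˢ R)
        (fun p => testDev fun v => t p.2 v (B ⟨j, hij'⟩ (f p.1, g p.2))) (l := l)
        (by rwa [abs_of_nonneg hl]) (fun p u => abs_testDev_le _ u) (fun p => sum_testDev _)
      rw [Fintype.card_prod X Y] at this
      simpa [Z, Equiv.piSplitAt, hij'] using this
    refine (Finset.sum_le_sum fun B _ => key B).trans (le_of_eq ?_)
    rw [Finset.sum_const, Finset.card_univ, nsmul_eq_mul]
    push_cast
    ring
  · refine lt_of_le_of_lt (mul_le_mul_of_nonneg_right ?_ (by positivity)) hcard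
    norm_cast
    simp only [E, Fintype.card_prod, Fintype.card_finset, Fintype.card_fun, Fintype.card_bool]
    rw [mul_assoc (2 ^ Fintype.card X * 2 ^ Fintype.card Y), ← mul_assoc (2 ^ _ * 2 ^ _)]
    refine Nat.mul_le_mul_right _ ?_
    calc _ ≤ Fintype.card (I × I) := Fintype.card_subtype_le _
      _ = _ := by rw [Fintype.card_prod, sq]

end Deviation

section Distributions

variable {α β : Type*}

lemma PMF.sum_toReal_map_mul [Fintype α] [Fintype β] (p : PMF α) (f : α → β) (h : β → ℝ) :
    ∑ z, ((p.map f) z).toReal * h z = ∑ a, (p a).toReal * h (f a) := by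
  classical
  have h1 : ∀ z, ((p.map f) z).toReal = ∑ a, if z = f a then (p a).toReal else 0 := fun z => by
    rw [PMF.map_apply, tsum_fintype, ENNReal.toReal_sum]
    · refine Finset.sum_congr rfl fun a _ => ?_
      split_ifs <;> simp
    · intro a _
      split_ifs
      · exact p.apply_ne_top a
      · simp
  simp_rw [h1, Finset.sum_mul]
  rw [Finset.sum_comm]
  refine Finset.sum_congr rfl fun a _ => ?_
  simp [ite_mul]

lemma prodPMF_apply (p : PMF α) (q : PMF β) (z : α × β) :
    prodPMF p q z = p z.1 * q z.2 := by
  classical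
  obtain ⟨a, b⟩ := z
  rw [prodPMF, PMF.bind_apply, tsum_eq_single a]
  · rw [PMF.map_apply, tsum_eq_single b]
    · simp
    · intro b' hb'
      simp [Ne.symm hb']
  · intro a' ha'
    simp [PMF.map_apply, Ne.symm ha']

lemma sum_toReal_prodPMF_mul [Fintype α] [Fintype β] (p : PMF α) (q : PMF β) (h : α × β → ℝ) :
    ∑ z, (prodPMF p q z).toReal * h z =
      ∑ a, (p a).toReal * ∑ b, (q b).toReal * h (a, b) := by
  rw [Fintype.sum_prod_type]
  simp [prodPMF_apply, Finset.mul_sum, mul_assoc]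

/-- A joint distribution whose first marginal is bounded by `c` pointwise is dominated by `c` times
the sum over the graph of a partial function. -/
lemma exists_sum_toReal_mul_le [Fintype α] [Fintype β] [Nonempty β] (P : PMF (α × β)) {c : ℝ}
    (hP : ∀ x, ((P.map Prod.fst) x).toReal ≤ c) (H : α × β → ℝ) :
    ∃ (S : Finset α) (f : α → β), ∑ z, (P z).toReal * H z ≤ c * ∑ x ∈ S, H (x, f x) := by
  classical
  choose f hf using fun x => Finite.exists_max fun y => H (x, y)
  refine ⟨Finset.univ.filter fun x => 0 ≤ H (x, f x), f, ?_⟩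
  calc ∑ z, (P z).toReal * H z ≤ ∑ z : α × β, (P z).toReal * max (H (z.1, f z.1)) 0 :=
        Finset.sum_le_sum fun z _ =>
          mul_le_mul_of_nonneg_left (le_max_of_le_left (hf z.1 z.2)) ENNReal.toReal_nonneg
    _ = ∑ x, ((P.map Prod.fst) x).toReal * max (H (x, f x)) 0 :=
        (PMF.sum_toReal_map_mul P Prod.fst fun x => max (H (x, f x)) 0).symm
    _ ≤ ∑ x, c * max (H (x, f x)) 0 :=
        Finset.sum_le_sum fun x _ => mul_le_mul_of_nonneg_right (hP x) (le_max_right _ _)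
    _ = _ := by
        rw [← Finset.mul_sum, Finset.sum_filter]
        congr 1
        refine Finset.sum_congr rfl fun x _ => ?_
        split_ifs with h
        · exact max_eq_left h
        · exact max_eq_right (not_le.1 h).le

end Distributions

lemma sd_le {α : Type*} [Fintype α] {p q : PMF α} {ε : ℝ}
    (h : ∀ T : Finset α, |∑ x ∈ T, (p x).toReal - ∑ x ∈ T, (q x).toReal| ≤ ε) : sd p q ≤ ε :=
  ciSup_le h

/-- Small deviation on rectangles implies the correlation breaker property. -/
lemma isStrongAdvCB_of_sum_testDev_lt {n n' a m : ℕ} {k k' ε : ℝ}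
    (F : Bits a → Bits n × Bits n' → Bits m)
    (hF : ∀ i j, i ≠ j → ∀ (S : Finset (Bits n)) (R : Finset (Bits n')) (f : Bits n → Bits n)
      (g : Bits n' → Bits n') (t : Bits n' → Bits m → Bits m → Bool),
      ∑ p ∈ S ×ˢ R, testDev (fun v => t p.2 v (F j (f p.1, g p.2))) (F i p) <
        ε * (2 : ℝ) ^ (k + k')) :
    IsStrongAdvCB k k' ε fun x y i => F i (x, y) := by
  intro PX PY hX hY i j hij
  let G : (Bits m × Bits m × (Bits n' × Bits n') → Bool) → Bits n × Bits n → Bits n' × Bits n' → ℝ :=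
    fun t z w => testDev (fun v => t (v, F j (z.2, w.2), w)) (F i (z.1, w.1))
  have upper : ∀ t, ∑ z, (PX z).toReal * ∑ w, (PY w).toReal * G t z w ≤ ε := by
    intro t
    obtain ⟨S, f, hS⟩ := exists_sum_toReal_mul_le PX hX fun z => ∑ w, (PY w).toReal * G t z w
    obtain ⟨R, g, hR⟩ := exists_sum_toReal_mul_le PY hY fun w => ∑ x ∈ S, G t (x, f x) w
    have h := hF i j hij S R f g fun y u v => t (u, v, (y, g y))
    rw [Finset.sum_product_right] at h
    refine hS.trans ?_
    have hswap : ∑ x ∈ S, ∑ w, (PY w).toReal * G t (x, f x) w =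
        ∑ w, (PY w).toReal * ∑ x ∈ S, G t (x, f x) w := by
      rw [Finset.sum_comm]
      simp_rw [Finset.mul_sum]
    rw [hswap]
    calc (2 : ℝ) ^ (-k) * ∑ w, (PY w).toReal * ∑ x ∈ S, G t (x, f x) w
        ≤ 2 ^ (-k) * (2 ^ (-k') * (ε * (2 : ℝ) ^ (k + k'))) := by
          refine mul_le_mul_of_nonneg_left (hR.trans ?_) (by positivity)
          exact mul_le_mul_of_nonneg_left h.le (by positivity)
      _ = ε * (2 ^ (-k) * 2 ^ (-k') * (2 : ℝ) ^ (k + k')) := by ring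
      _ = ε := by
          rw [← Real.rpow_add two_pos, ← Real.rpow_add two_pos]
          ring_nf
          simp
  refine sd_le fun T => ?_
  classical
  let t : Bits m × Bits m × (Bits n' × Bits n') → Bool := fun z => decide (z ∈ T)
  have hsum : ∀ p : PMF (Bits m × Bits m × (Bits n' × Bits n')),
      ∑ x ∈ T, (p x).toReal = ∑ x, (p x).toReal * if t x then 1 else 0 := fun p => by
    simp [t]
  have hdiff : ∑ z ∈ T, (((prodPMF PX PY).map fun p =>
        (F i (p.1.1, p.2.1), F j (p.1.2, p.2.2), p.2)) z).toReal -
      ∑ z ∈ T, ((prodPMF (PMF.uniformOfFintype (Bits m))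
        ((prodPMF PX PY).map fun p => (F j (p.1.2, p.2.2), p.2))) z).toReal =
      ∑ z, (PX z).toReal * ∑ w, (PY w).toReal * G t z w := by
    rw [hsum, hsum, PMF.sum_toReal_map_mul, sum_toReal_prodPMF_mul, sum_toReal_prodPMF_mul]
    simp_rw [PMF.sum_toReal_map_mul, sum_toReal_prodPMF_mul]
    have hu : ∀ u : Bits m, (PMF.uniformOfFintype (Bits m) u).toReal =
        (Fintype.card (Bits m) : ℝ)⁻¹ := fun u => by
      rw [PMF.uniformOfFintype_apply, ENNReal.toReal_inv, ENNReal.toReal_natCast]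
    simp_rw [hu, G, testDev, mul_sub, Finset.sum_sub_distrib, mul_sub, Finset.sum_sub_distrib]
    congr 1
    simp_rw [Finset.mul_sum]
    rw [Finset.sum_comm]
    refine Finset.sum_congr rfl fun z _ => ?_
    rw [Finset.sum_comm]
    refine Finset.sum_congr rfl fun w _ => Finset.sum_congr rfl fun u _ => ?_
    ring
  rw [hdiff, abs_le]
  refine ⟨?_, upper t⟩
  have h := upper fun z => !t z
  simp only [G, testDev_not, mul_neg, Finset.sum_neg_distrib] at h
  linarith

lemma ten_mul_le_two_rpow {x : ℝ} (hx : 10000 ≤ x) : 10 * x ≤ (2 : ℝ) ^ (0.1 * x) := by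
  have h1 : 0.034 * x ≤ (2 : ℝ) ^ (0.05 * x) := by
    rw [Real.rpow_def_of_pos two_pos]
    have := Real.add_one_le_exp (Real.log 2 * (0.05 * x))
    nlinarith [Real.log_two_gt_d9]
  have h2 : (2 : ℝ) ^ (0.1 * x) = 2 ^ (0.05 * x) * 2 ^ (0.05 * x) := by
    rw [← Real.rpow_add two_pos]
    ring_nf
  rw [h2]
  nlinarith [mul_le_mul h1 h1 (by positivity) (by positivity)]

lemma two_rpow_neg_le_of_logb_le {ε x : ℝ} (hε : 0 < ε) (h : Real.logb 2 (1 / ε) ≤ x) :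
    (2 : ℝ) ^ (-x) ≤ ε := by
  rw [one_div, Real.logb_inv] at h
  calc (2 : ℝ) ^ (-x) ≤ 2 ^ Real.logb 2 ε :=
        Real.rpow_le_rpow_of_exponent_le one_le_two (by linarith)
    _ = ε := Real.rpow_logb two_pos (by norm_num) hε

/-- The number of events is beaten by the deviation bound. -/
lemma card_exponent_lt {ε : ℝ} {a d m : ℕ} (hd : 10000 ≤ (d : ℝ)) (ha : (a : ℝ) ≤ d)
    (hm : (m : ℝ) ≤ d / 50) (hε : (2 : ℝ) ^ (-(0.05 * d : ℝ)) ≤ ε) :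
    ((2 * a + (2 * 2 ^ d + 2 * (d * 2 ^ d)) + 2 ^ m * 2 ^ m * 2 ^ d : ℕ) : ℝ) <
      (ε * (2 : ℝ) ^ (0.9 * d + 0.9 * d : ℝ)) ^ 2 / (4 * (2 ^ d * 2 ^ d)) := by
  set q : ℝ := 2 ^ (0.1 * d : ℝ) with hq
  have hq10 : 10 * (d : ℝ) ≤ q := ten_mul_le_two_rpow hd
  have hN : (2 : ℝ) ^ d = q ^ 10 := by
    rw [hq, ← Real.rpow_mul_natCast two_pos.le, ← Real.rpow_natCast]
    congr 1
    push_cast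
    ring
  have hK : (2 : ℝ) ^ (0.9 * d + 0.9 * d : ℝ) = q ^ 18 := by
    rw [hq, ← Real.rpow_mul_natCast two_pos.le]
    congr 1
    push_cast
    ring
  have hM : (2 : ℝ) ^ m * 2 ^ m ≤ q := by
    rw [hq, ← Real.rpow_natCast, ← Real.rpow_add two_pos]
    exact Real.rpow_le_rpow_of_exponent_le one_le_two (by linarith)
  have hq0 : 0 < q := by positivity
  have hε2 : 1 ≤ ε ^ 2 * q := by
    have h1 : ((2 : ℝ) ^ (-(0.05 * d : ℝ))) ^ 2 * q = 1 := by
      rw [hq, ← Real.rpow_mul_natCast two_pos.le, ← Real.rpow_add two_pos]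
      convert Real.rpow_zero (2 : ℝ) using 2
      push_cast
      ring
    rw [← h1]
    gcongr
  push_cast
  rw [hN, hK]
  have hq1 : 100000 ≤ q := by linarith
  have hr : q ^ 15 / 4 ≤ (ε * q ^ 18) ^ 2 / (4 * (q ^ 10 * q ^ 10)) := by
    rw [div_le_div_iff₀ (by positivity) (by positivity)]
    nlinarith [mul_le_mul_of_nonneg_right hε2 (by positivity : 0 ≤ 4 * q ^ 35)]
  refine lt_of_lt_of_le ?_ hr
  have hq10' : 1 ≤ q ^ 10 := one_le_pow₀ (by linarith)
  have h5 : 3 * q < q ^ 5 / 4 := by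
    have : 1 ≤ q ^ 3 := one_le_pow₀ (by linarith)
    nlinarith [mul_le_mul_of_nonneg_left this (by positivity : 0 ≤ q ^ 2)]
  calc 2 * (a : ℝ) + (2 * q ^ 10 + 2 * (d * q ^ 10)) + 2 ^ m * 2 ^ m * q ^ 10
      ≤ q * q ^ 10 + (q * q ^ 10 / 2 + q * q ^ 10 / 2) + q * q ^ 10 := by
        gcongr <;> nlinarith
    _ = 3 * q * q ^ 10 := by ring
    _ < q ^ 5 / 4 * q ^ 10 := by gcongr
    _ = q ^ 15 / 4 := by ring

lemma exists_isStrongAdvCB {ε : ℝ} {a d m : ℕ} (hε : 0 < ε) (hε1 : ε ≤ 1)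
    (h : ((2 * a + (2 * 2 ^ d + 2 * (d * 2 ^ d)) + 2 ^ m * 2 ^ m * 2 ^ d : ℕ) : ℝ) <
      (ε * (2 : ℝ) ^ (0.9 * d + 0.9 * d : ℝ)) ^ 2 / (4 * (2 ^ d * 2 ^ d))) :
    ∃ CB : Bits d → Bits d → Bits a → Bits m, IsStrongAdvCB (0.9 * d) (0.9 * d) ε CB := by
  set τ : ℝ := ε * (2 : ℝ) ^ (0.9 * d + 0.9 * d : ℝ) with hτ
  set n : ℝ := 2 ^ d * 2 ^ d with hn
  have hn0 : 0 < n := by positivity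
  have hτ0 : 0 < τ := by positivity
  have hτn : τ ≤ n := by
    rw [hτ, hn, ← Real.rpow_natCast, ← Real.rpow_add two_pos, ← one_mul ((2 : ℝ) ^ ((d : ℝ) + d))]
    refine mul_le_mul hε1 ?_ (by positivity) zero_le_one
    · refine Real.rpow_le_rpow_of_exponent_le one_le_two ?_
      have : (0 : ℝ) ≤ d := by positivity
      linarith
  obtain ⟨F, hF⟩ := exists_forall_sum_testDev_lt (I := Bits a) (X := Bits d) (Y := Bits d)
    (M := Bits m) (l := τ / (2 * n)) (τ := τ) (by positivity)
    (by rw [div_le_one (by positivity)]; linarith) (by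
      simp only [Fintype.card_fun, Fintype.card_fin, Fintype.card_bool]
      have hpow : (2 ^ a) ^ 2 * (2 ^ 2 ^ d * 2 ^ 2 ^ d * ((2 ^ d) ^ 2 ^ d * (2 ^ d) ^ 2 ^ d) *
          ((2 ^ 2 ^ m) ^ 2 ^ m) ^ 2 ^ d) =
          2 ^ (2 * a + (2 * 2 ^ d + 2 * (d * 2 ^ d)) + 2 ^ m * 2 ^ m * 2 ^ d) := by
        simp only [← pow_mul, ← pow_add]
        congr 1
        ring
      rw [hpow]
      set e := 2 * a + (2 * 2 ^ d + 2 * (d * 2 ^ d)) + 2 ^ m * 2 ^ m * 2 ^ d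
      have h2 : ((2 ^ e : ℕ) : ℝ) ≤ Real.exp e := by
        rw [← Real.exp_one_pow]
        push_cast
        gcongr
        linarith [Real.exp_one_gt_d9]
      calc _ ≤ Real.exp e * Real.exp ((τ / (2 * n)) ^ 2) ^ (2 ^ d * 2 ^ d) := by gcongr
        _ = Real.exp (e + n * (τ / (2 * n)) ^ 2) := by
            rw [← Real.exp_nat_mul, ← Real.exp_add, hn]
            push_cast
            rfl
        _ < _ := by
            rw [Real.exp_lt_exp]
            have h3 : τ / (2 * n) * τ = τ ^ 2 / (4 * n) + n * (τ / (2 * n)) ^ 2 := by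
              field_simp
              ring
            rw [h3]
            gcongr)
  exact ⟨_, isStrongAdvCB_of_sum_testDev_lt F hF⟩

/-- There exist constants `C > 1` and `α > 0` such that for every `0 < ε < 1/2` and all
`a, d` with `d ≥ C(a + log₂(1/ε))` there is a `(0.9d, 0.9d, ε)` strong correlation
breaker with advice `AdvCB : {0,1}^d × {0,1}^d × {0,1}^a → {0,1}^m`, `m ≥ α d`. -/
theorem stmt_17 :
    ∃ C : ℝ, C > 1 ∧
      ∃ α : ℝ, α > 0 ∧
        ∀ ε : ℝ, 0 < ε → ε < 1 / 2 →
          ∀ a d : ℕ, (d : ℝ) ≥ C * (a + Real.logb 2 (1 / ε)) →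
            ∃ m : ℕ, (m : ℝ) ≥ α * d ∧
              ∃ AdvCB : Bits d → Bits d → Bits a → Bits m,
                IsStrongAdvCB (0.9 * d) (0.9 * d) ε AdvCB := by
  refine ⟨10000, by norm_num, 1 / 100, by norm_num, fun ε hε hε2 a d hd => ?_⟩
  have hlog : 1 ≤ Real.logb 2 (1 / ε) := by
    rw [Real.le_logb_iff_rpow_le one_lt_two (by positivity), Real.rpow_one,
      le_div_iff₀ hε]
    linarith
  have ha : (0 : ℝ) ≤ a := by positivity
  have hm := Nat.ceil_lt_add_one (a := (1 / 100 : ℝ) * d) (by positivity)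
  refine ⟨⌈(1 / 100 : ℝ) * d⌉₊, Nat.le_ceil _, exists_isStrongAdvCB hε (by linarith) ?_⟩
  refine card_exponent_lt (by linarith) (by linarith) (by linarith) ?_
  exact two_rpow_neg_le_of_logb_le hε (by linarith)
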